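/- arXiv:2012.15447 — 4 statements merged into one kernel-verified Lean document; each statement's English description precedes it below -/
import Mathlib

section
/- Let I_1, …, I_r be strongly stable ideals in S = K[x_1, …, x_n] over a field K, where each I_i is minimally generated by monomials u_{i,1}, …, u_{i,s_i}, all of the same degree d_i. Let φ : S[T_{i,j} : 1 ≤ i ≤ r, 1 ≤ j ≤ s_i] → S[t_1, …, t_r] be the S-algebra homomorphism with T_{i,j} ↦ u_{i,j}·t_i, and let φ' : K[T_{i,j}] → K[x_1, …, x_n, t_1, …, t_r] be the induced K-algebra map T_{i,j} ↦ u_{i,j}·t_i, with toric ideal T(I_1 ⊕ … ⊕ I_r) = ker φ'. Suppose G is a finite set of marked binomials contained in ker φ' for which there exists a monomial order on K[T_{i,j}] making G a Gröbner basis of ker φ' with the marked terms as initial terms. Then there exists a monomial order on S[T_{i,j}] for which G' = { x_i·T_{l,k} − x_j·T_{l,k'} : i < j and x_i·u_{l,k} = x_j·u_{l,k'} } ∪ G, with each binomial x_i·T_{l,k} − x_j·T_{l,k'} marked at x_i·T_{l,k} and the elements of G keeping their original marked terms, is a Gröbner basis of ker φ with the marked terms as initial terms. -/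
/-- A marked binomial: the difference of two monomials (given by exponent vectors),
with `head` chosen as the marked term. -/
structure MarkedBinomial (V : Type*) where
  head : V →₀ ℕ
  tail : V →₀ ℕ

/-- The polynomial associated to a marked binomial. -/
noncomputable def MarkedBinomial.toPoly {V : Type*} (K : Type*) [Field K]
    (g : MarkedBinomial V) : MvPolynomial V K :=
  MvPolynomial.monomial g.head 1 - MvPolynomial.monomial g.tail 1

/-- Transport a marked binomial along a map of variables. -/
noncomputable def MarkedBinomial.map {V W : Type*} (f : V → W) (g : MarkedBinomial V) :
    MarkedBinomial W :=
  ⟨Finsupp.mapDomain f g.head, Finsupp.mapDomain f g.tail⟩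

/-- A monomial order on the exponent vectors `V →₀ ℕ`: a strict total order, compatible
with addition, for which `1` (the zero exponent vector) is the smallest monomial. -/
structure MonomialOrd (V : Type*) where
  gt : (V →₀ ℕ) → (V →₀ ℕ) → Prop
  irrefl : ∀ m, ¬ gt m m
  trans : ∀ {m₁ m₂ m₃}, gt m₁ m₂ → gt m₂ m₃ → gt m₁ m₃
  total : ∀ m₁ m₂, m₁ ≠ m₂ → gt m₁ m₂ ∨ gt m₂ m₁
  add_right : ∀ {m₁ m₂} (m₃), gt m₁ m₂ → gt (m₁ + m₃) (m₂ + m₃)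
  gt_zero : ∀ m, m ≠ 0 → gt m 0

/-- `m` is the initial (leading) exponent of `f` with respect to the strict order `gt`. -/
def IsInitialTerm {V K : Type*} [Field K] (gt : (V →₀ ℕ) → (V →₀ ℕ) → Prop)
    (f : MvPolynomial V K) (m : V →₀ ℕ) : Prop :=
  m ∈ f.support ∧ ∀ m' ∈ f.support, m' ≠ m → gt m m'

/-- A set `G` of marked binomials is a Gröbner basis of the ideal `J` with respect to the
order `gt`, with the marked terms as initial terms: `G ⊆ J`, each marked term is the
initial term of its binomial, and the marked terms generate the initial ideal of `J`. -/
def IsMarkedGB {V K : Type*} [Field K] (gt : (V →₀ ℕ) → (V →₀ ℕ) → Prop)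
    (G : Set (MarkedBinomial V)) (J : Ideal (MvPolynomial V K)) : Prop :=
  (∀ g ∈ G, g.toPoly K ∈ J) ∧ (∀ g ∈ G, gt g.head g.tail) ∧
    Ideal.span ((fun g => (MvPolynomial.monomial g.head (1 : K) : MvPolynomial V K)) '' G) =
      Ideal.span {p : MvPolynomial V K |
        ∃ f ∈ J, f ≠ 0 ∧ ∃ m, IsInitialTerm gt f m ∧ p = MvPolynomial.monomial m (1 : K)}

/-- One-step reduction of a monomial (exponent vector) with respect to a collection of
marked binomials: replace an occurrence of a marked term by the corresponding tail. -/
def Reduces {V : Type*} (G : Set (MarkedBinomial V)) (m m' : V →₀ ℕ) : Prop :=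
  ∃ g ∈ G, g.head ≤ m ∧ m' = m - g.head + g.tail

/-- One-step reduction of a polynomial with respect to a collection of marked binomials. -/
noncomputable def PolyReduces {V K : Type*} [Field K] (G : Set (MarkedBinomial V))
    (f f' : MvPolynomial V K) : Prop :=
  ∃ g ∈ G, ∃ m ∈ f.support, g.head ≤ m ∧
    f' = f - MvPolynomial.monomial (m - g.head) (MvPolynomial.coeff m f) * g.toPoly K

/-- The image monomial (in the `W`-variables) of a monomial `T` in the `V`-variables under
the monomial map sending the variable `v` to the monomial with exponent vector `u v`. -/
noncomputable def fiberMap {V W : Type*} (u : V → (W →₀ ℕ)) (T : V →₀ ℕ) : W →₀ ℕ :=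
  T.sum fun v e => e • u v

/-- `T` is a sink of the fiber graph over the multidegree `μ` (with respect to the
marked binomials `G` and the monomial map determined by `u`): it lies in the fiber and
has no outgoing edge inside the fiber. -/
noncomputable def IsFiberSink {V W : Type*} (G : Set (MarkedBinomial V)) (u : V → (W →₀ ℕ))
    (μ : W →₀ ℕ) (T : V →₀ ℕ) : Prop :=
  fiberMap u T = μ ∧ ∀ T', Reduces G T T' → fiberMap u T' ≠ μ

/-- `I` is a monomial ideal. -/
def IsMonomialIdeal {n : ℕ} {K : Type*} [Field K] (I : Ideal (MvPolynomial (Fin n) K)) : Prop :=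
  ∃ M : Set (Fin n →₀ ℕ), I = Ideal.span ((fun m => (MvPolynomial.monomial m (1 : K))) '' M)

/-- `I` is a strongly stable (Borel) ideal: a monomial ideal such that whenever `x_i`
divides a monomial `m ∈ I` and `j < i`, also `x_j · m / x_i ∈ I`. -/
def StronglyStable {n : ℕ} {K : Type*} [Field K] (I : Ideal (MvPolynomial (Fin n) K)) : Prop :=
  IsMonomialIdeal I ∧ ∀ m : Fin n →₀ ℕ, MvPolynomial.monomial m (1 : K) ∈ I →
    ∀ i j : Fin n, j < i → m i ≠ 0 →
      MvPolynomial.monomial (m - Finsupp.single i 1 + Finsupp.single j 1) (1 : K) ∈ I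

/-- The smallest strongly stable ideal containing the given monomials. -/
noncomputable def smallestStronglyStable {n : ℕ} (K : Type*) [Field K]
    (Ms : Set (Fin n →₀ ℕ)) : Ideal (MvPolynomial (Fin n) K) :=
  sInf {I | StronglyStable I ∧ ∀ m ∈ Ms, MvPolynomial.monomial m (1 : K) ∈ I}

/-- The minimal monomial generators of an ideal generated in the single degree `d`:
the degree-`d` monomials lying in `I`. -/
def MinGens {n : ℕ} {K : Type*} [Field K] (I : Ideal (MvPolynomial (Fin n) K)) (d : ℕ) :
    Set (Fin n →₀ ℕ) :=
  {m | (m.sum fun _ e => e) = d ∧ MvPolynomial.monomial m (1 : K) ∈ I}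

/-- `u ≻_rlex v` (reverse lexicographic, `x_1 > … > x_n`, for exponent vectors of equal
total degree): at the largest index where they differ, `u` has the smaller exponent. -/
def RlexGt {n : ℕ} (u v : Fin n →₀ ℕ) : Prop :=
  ∃ k : Fin n, u k < v k ∧ ∀ l : Fin n, k < l → u l = v l

/-- The (degree-)reverse lexicographic order on monomials of `K[V]` induced by the strict
variable order `vgt` (where `vgt k l` means the variable `k` is greater than `l`). -/
def VarRevlexGt {V : Type*} (vgt : V → V → Prop) (m m' : V →₀ ℕ) : Prop :=
  (m.sum fun _ e => e) > (m'.sum fun _ e => e) ∨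
    ((m.sum fun _ e => e) = (m'.sum fun _ e => e) ∧
      ∃ k, m k < m' k ∧ ∀ l, vgt k l → m l = m' l)

/-- The minimal monomial generators of the strongly stable ideal `B(x_a x_b)` (`a ≤ b`):
the monomials `x_i x_j` with `i ≤ j`, `i ≤ a`, `j ≤ b`. -/
def BM {n : ℕ} (a b : Fin n) : Set (Fin n →₀ ℕ) :=
  {m | ∃ i j : Fin n, i ≤ j ∧ i ≤ a ∧ j ≤ b ∧ m = Finsupp.single i 1 + Finsupp.single j 1}

/-- The minimal monomial generators of `B(x_c x_d)` not in `B(x_a x_b)` (for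
`c < a ≤ b < d`): the monomials `x_i x_j` with `i ≤ c` and `b < j ≤ d`. -/
def BN {n : ℕ} (b c d : Fin n) : Set (Fin n →₀ ℕ) :=
  {m | ∃ i j : Fin n, i ≤ c ∧ b < j ∧ j ≤ d ∧ m = Finsupp.single i 1 + Finsupp.single j 1}

/-- `u ≻_mrlex v`: every element of `B_N` is greater than every element of `B_M`, and
within `B_M` (resp. `B_N`) the order agrees with `≻_rlex`. -/
def MrlexGt {n : ℕ} (a b c d : Fin n) (u v : Fin n →₀ ℕ) : Prop :=
  (u ∈ BN b c d ∧ v ∈ BM a b) ∨ (u ∈ BM a b ∧ v ∈ BM a b ∧ RlexGt u v) ∨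
    (u ∈ BN b c d ∧ v ∈ BN b c d ∧ RlexGt u v)

/-- The collection `G₁` of marked binomials `T_u T_v − T_{u'} T_{v'}` with `u v = u' v'`
and `u, v ≻_rlex v'`, marked at `T_u T_v`. -/
def G1 {n : ℕ} (a b c d : Fin n) : Set (MarkedBinomial ↥(BM a b ∪ BN b c d)) :=
  {g | ∃ u v u' v' : ↥(BM a b ∪ BN b c d),
    (u : Fin n →₀ ℕ) + (v : Fin n →₀ ℕ) = (u' : Fin n →₀ ℕ) + (v' : Fin n →₀ ℕ) ∧
    RlexGt (u : Fin n →₀ ℕ) (v' : Fin n →₀ ℕ) ∧ RlexGt (v : Fin n →₀ ℕ) (v' : Fin n →₀ ℕ) ∧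
    g.head = Finsupp.single u 1 + Finsupp.single v 1 ∧
    g.tail = Finsupp.single u' 1 + Finsupp.single v' 1}

/-- The collection `G₂` of marked binomials `T_u T_v − T_{u'} T_{v'}` with `u v = u' v'`
and `u, v ≻_mrlex v'`, marked at `T_u T_v`. -/
def G2 {n : ℕ} (a b c d : Fin n) : Set (MarkedBinomial ↥(BM a b ∪ BN b c d)) :=
  {g | ∃ u v u' v' : ↥(BM a b ∪ BN b c d),
    (u : Fin n →₀ ℕ) + (v : Fin n →₀ ℕ) = (u' : Fin n →₀ ℕ) + (v' : Fin n →₀ ℕ) ∧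
    MrlexGt a b c d (u : Fin n →₀ ℕ) (v' : Fin n →₀ ℕ) ∧
    MrlexGt a b c d (v : Fin n →₀ ℕ) (v' : Fin n →₀ ℕ) ∧
    g.head = Finsupp.single u 1 + Finsupp.single v 1 ∧
    g.tail = Finsupp.single u' 1 + Finsupp.single v' 1}

/-- `w` is the smallest (with respect to the variable order induced by `≻_rlex`) variable
factor of the monomial `T` whose underlying monomial lies in `S`. -/
def IsLeastFactorIn {n : ℕ} {V : Set (Fin n →₀ ℕ)} (S : Set (Fin n →₀ ℕ))
    (T : ↥V →₀ ℕ) (w : ↥V) : Prop :=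
  w ∈ T.support ∧ (w : Fin n →₀ ℕ) ∈ S ∧
    ∀ v ∈ T.support, (v : Fin n →₀ ℕ) ∈ S →
      v = w ∨ RlexGt (v : Fin n →₀ ℕ) (w : Fin n →₀ ℕ)

/-- `m` is the `≻_rlex`-smallest element of `S` dividing `μ`. -/
def IsLeastDivisorIn {n : ℕ} (S : Set (Fin n →₀ ℕ)) (μ m : Fin n →₀ ℕ) : Prop :=
  m ∈ S ∧ m ≤ μ ∧ ∀ m' ∈ S, m' ≤ μ → m' = m ∨ RlexGt m' m

namespace MonomialOrd

/-- The lexicographic order with the variable of smallest index being the largest. -/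
noncomputable def lex (V : Type*) [LinearOrder V] : MonomialOrd V where
  gt a b := toLex b < toLex a
  irrefl _ := lt_irrefl _
  trans h₁ h₂ := h₂.trans h₁
  total a b h := by
    rcases lt_trichotomy (toLex a) (toLex b) with h' | h' | h'
    · exact Or.inr h'
    · exact absurd (toLex.injective h') h
    · exact Or.inl h'
  add_right c h := by
    rw [toLex_add, toLex_add]
    exact add_lt_add_left h _
  gt_zero m h := by
    refine lt_of_le_of_ne (Finsupp.toLex_monotone zero_le) fun h' => h ?_
    exact (toLex.injective h').symm

/-- The block order comparing the `V`-parts first and breaking ties with the `W`-parts. -/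
noncomputable def block {V W : Type*} (o₁ : MonomialOrd V) (o₂ : MonomialOrd W) :
    MonomialOrd (V ⊕ W) where
  gt a b :=
    o₁.gt (Finsupp.sumFinsuppAddEquivProdFinsupp a).1 (Finsupp.sumFinsuppAddEquivProdFinsupp b).1 ∨
      (Finsupp.sumFinsuppAddEquivProdFinsupp a).1 = (Finsupp.sumFinsuppAddEquivProdFinsupp b).1 ∧
        o₂.gt (Finsupp.sumFinsuppAddEquivProdFinsupp a).2
          (Finsupp.sumFinsuppAddEquivProdFinsupp b).2
  irrefl m := by
    rintro (h | ⟨-, h⟩)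
    exacts [o₁.irrefl _ h, o₂.irrefl _ h]
  trans := by
    rintro a b c (h | ⟨h, h'⟩) (k | ⟨k, k'⟩)
    · exact Or.inl (o₁.trans h k)
    · exact Or.inl (k ▸ h)
    · exact Or.inl (h ▸ k)
    · exact Or.inr ⟨h.trans k, o₂.trans h' k'⟩
  total a b h := by
    by_cases h₁ : (Finsupp.sumFinsuppAddEquivProdFinsupp a).1 =
        (Finsupp.sumFinsuppAddEquivProdFinsupp b).1
    · have h₂ : (Finsupp.sumFinsuppAddEquivProdFinsupp a).2 ≠
          (Finsupp.sumFinsuppAddEquivProdFinsupp b).2 := fun h₂ =>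
        h (Finsupp.sumFinsuppAddEquivProdFinsupp.injective (Prod.ext h₁ h₂))
      exact (o₂.total _ _ h₂).imp (fun k => Or.inr ⟨h₁, k⟩) fun k => Or.inr ⟨h₁.symm, k⟩
    · exact (o₁.total _ _ h₁).imp Or.inl Or.inl
  add_right c h := by
    rw [map_add, map_add]
    rcases h with h | ⟨h, h'⟩
    · exact Or.inl (o₁.add_right _ h)
    · exact Or.inr ⟨by rw [Prod.fst_add, Prod.fst_add, h], o₂.add_right _ h'⟩
  gt_zero m h := by
    rw [map_zero]
    by_cases h₁ : (Finsupp.sumFinsuppAddEquivProdFinsupp m).1 = 0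
    · refine Or.inr ⟨h₁, o₂.gt_zero _ fun h₂ => h ?_⟩
      rw [← map_eq_zero_iff _ Finsupp.sumFinsuppAddEquivProdFinsupp.injective]
      exact Prod.ext h₁ h₂
    · exact Or.inl (o₁.gt_zero _ h₁)

end MonomialOrd

section Toric

variable {V W K : Type*} [Field K]

lemma aeval_monomial_eq_monomial_fiberMap (w : V → (W →₀ ℕ)) (a : V →₀ ℕ) (c : K) :
    MvPolynomial.aeval (fun v => MvPolynomial.monomial (w v) (1 : K)) (MvPolynomial.monomial a c) =
      MvPolynomial.monomial (fiberMap w a) c := by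
  rw [MvPolynomial.aeval_monomial, fiberMap, MvPolynomial.algebraMap_eq]
  simp only [MvPolynomial.monomial_pow, one_pow]
  rw [Finsupp.prod, Finsupp.sum, ← MvPolynomial.monomial_sum_one, MvPolynomial.C_mul_monomial,
    mul_one]

lemma toPoly_mem_ker_iff (w : V → (W →₀ ℕ)) (g : MarkedBinomial V) :
    g.toPoly K ∈ RingHom.ker
        (MvPolynomial.aeval (R := K)
          fun v => MvPolynomial.monomial (w v) (1 : K)).toRingHom ↔
      fiberMap w g.head = fiberMap w g.tail := by
  rw [RingHom.mem_ker, AlgHom.toRingHom_eq_coe, RingHom.coe_coe, MarkedBinomial.toPoly, map_sub,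
    aeval_monomial_eq_monomial_fiberMap, aeval_monomial_eq_monomial_fiberMap, sub_eq_zero]
  exact (MvPolynomial.monomial_left_injective one_ne_zero).eq_iff

/-- In an element of a toric ideal, every monomial shares its fiber with another one. -/
lemma exists_mem_support_fiberMap_eq (w : V → (W →₀ ℕ)) {f : MvPolynomial V K}
    (hf : f ∈ RingHom.ker
        (MvPolynomial.aeval (R := K)
          fun v => MvPolynomial.monomial (w v) (1 : K)).toRingHom)
    {m : V →₀ ℕ} (hm : m ∈ f.support) :
    ∃ m' ∈ f.support, m' ≠ m ∧ fiberMap w m = fiberMap w m' := by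
  classical
  by_contra! h
  rw [RingHom.mem_ker, AlgHom.toRingHom_eq_coe, RingHom.coe_coe] at hf
  have hc := congrArg (MvPolynomial.coeff (fiberMap w m)) hf
  rw [f.as_sum, map_sum, MvPolynomial.coeff_sum, Finset.sum_eq_single_of_mem m hm] at hc
  · rw [aeval_monomial_eq_monomial_fiberMap, MvPolynomial.coeff_monomial, if_pos rfl] at hc
    exact MvPolynomial.mem_support_iff.mp hm hc
  · intro b hb hbm
    rw [aeval_monomial_eq_monomial_fiberMap, MvPolynomial.coeff_monomial,
      if_neg (h b hb hbm).symm]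

lemma isInitialTerm_toPoly {gt : (V →₀ ℕ) → (V →₀ ℕ) → Prop} (hirr : ∀ m, ¬ gt m m)
    {g : MarkedBinomial V} (hg : gt g.head g.tail) : IsInitialTerm gt (g.toPoly K) g.head := by
  classical
  have hne : g.tail ≠ g.head := fun h => hirr g.head (by rwa [h] at hg)
  refine ⟨?_, fun m hm hmne => ?_⟩
  · rw [MvPolynomial.mem_support_iff, MarkedBinomial.toPoly, MvPolynomial.coeff_sub,
      MvPolynomial.coeff_monomial, MvPolynomial.coeff_monomial, if_pos rfl, if_neg hne, sub_zero]
    exact one_ne_zero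
  · rw [MvPolynomial.mem_support_iff, MarkedBinomial.toPoly, MvPolynomial.coeff_sub,
      MvPolynomial.coeff_monomial, MvPolynomial.coeff_monomial, if_neg hmne.symm] at hm
    have : g.tail = m := by
      by_contra h
      simp [h] at hm
    rwa [← this]

/-- Marked binomials form a Gröbner basis of a toric ideal iff they are oriented binomials of the
ideal and every monomial that is not the smallest one of its fiber is divisible by a marked term. -/
lemma isMarkedGB_toric_iff (w : V → (W →₀ ℕ)) {gt : (V →₀ ℕ) → (V →₀ ℕ) → Prop}
    (hirr : ∀ m, ¬ gt m m) (G : Set (MarkedBinomial V)) :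
    IsMarkedGB gt G (RingHom.ker
        (MvPolynomial.aeval (R := K)
          fun v => MvPolynomial.monomial (w v) (1 : K)).toRingHom) ↔
      (∀ g ∈ G, fiberMap w g.head = fiberMap w g.tail) ∧ (∀ g ∈ G, gt g.head g.tail) ∧
        ∀ m m', gt m m' → fiberMap w m = fiberMap w m' → ∃ g ∈ G, g.head ≤ m := by
  classical
  have himage : (fun g : MarkedBinomial V => MvPolynomial.monomial g.head (1 : K)) '' G =
      (fun m => MvPolynomial.monomial m (1 : K)) '' (MarkedBinomial.head '' G) := by
    rw [Set.image_image]
  have hmem : ∀ m, MvPolynomial.monomial m (1 : K) ∈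
      Ideal.span ((fun g : MarkedBinomial V => MvPolynomial.monomial g.head (1 : K)) '' G) ↔
        ∃ g ∈ G, g.head ≤ m := by
    intro m
    rw [himage, MvPolynomial.mem_ideal_span_monomial_image,
      MvPolynomial.support_monomial, if_neg one_ne_zero]
    simp
  have hpoly : ∀ {g : MarkedBinomial V}, gt g.head g.tail → g.toPoly K ≠ 0 := by
    intro g hg h0
    have := (isInitialTerm_toPoly (K := K) hirr hg).1
    simp [h0] at this
  simp only [IsMarkedGB, toPoly_mem_ker_iff]
  refine and_congr_right fun hker => and_congr_right fun hgt => ⟨fun hspan m m' hmm' hfib => ?_,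
    fun hdiv => le_antisymm ?_ ?_⟩
  · rw [← hmem, hspan]
    exact Ideal.subset_span ⟨(⟨m, m'⟩ : MarkedBinomial V).toPoly K,
      (toPoly_mem_ker_iff w _).mpr hfib, hpoly hmm', m, isInitialTerm_toPoly hirr hmm', rfl⟩
  · refine Ideal.span_mono ?_
    rintro _ ⟨g, hg, rfl⟩
    exact ⟨g.toPoly K, (toPoly_mem_ker_iff w g).mpr (hker g hg), hpoly (hgt g hg), g.head,
      isInitialTerm_toPoly hirr (hgt g hg), rfl⟩
  · rw [Ideal.span_le]
    rintro _ ⟨f, hf, -, m, hm, rfl⟩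
    obtain ⟨m', hm', hne, hfib⟩ := exists_mem_support_fiberMap_eq w hf hm.1
    exact (hmem m).mpr (hdiv m m' (hm.2 m' hm' hne) hfib)

lemma fiberMap_eq_linearCombination (w : V → (W →₀ ℕ)) (a : V →₀ ℕ) :
    fiberMap w a = Finsupp.linearCombination ℕ w a := rfl

lemma fiberMap_apply [Fintype V] (w : V → (W →₀ ℕ)) (a : V →₀ ℕ) (x : W) :
    fiberMap w a x = ∑ v, a v * w v x := by
  rw [fiberMap, Finsupp.sum_fintype _ _ (by simp), Finsupp.finsetSum_apply]
  simp

lemma fiberMap_mapDomain_inr {V' : Type*} (w : V' ⊕ V → (W →₀ ℕ)) (a : V →₀ ℕ) :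
    fiberMap w (Finsupp.mapDomain Sum.inr a) = fiberMap (w ∘ Sum.inr) a := by
  rw [fiberMap_eq_linearCombination, Finsupp.linearCombination_mapDomain,
    fiberMap_eq_linearCombination]

end Toric

/-- If two products have the same value and the first has the lexicographically larger
`x`-part, first differing at `i`, then some factor of its other part involves a variable beyond
`i`. -/
lemma exists_factor_of_lex_lt {ι P : Type*} [Fintype ι] [LinearOrder ι] [Fintype P]
    (U : P → ι → ℕ) {a b : ι → ℕ} {A B : P → ℕ}
    (hfib : ∀ i, a i + ∑ p, A p * U p i = b i + ∑ p, B p * U p i)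
    (hdeg : ∑ p, A p * ∑ i, U p i = ∑ p, B p * ∑ i, U p i)
    {i : ι} (hi : b i < a i) (hlt : ∀ j < i, b j = a j) :
    ∃ p, A p ≠ 0 ∧ ∃ j, i < j ∧ U p j ≠ 0 := by
  by_contra! h
  have hsum : ∑ j, ∑ p, A p * U p j < ∑ j, ∑ p, B p * U p j := by
    refine Finset.sum_lt_sum (fun j _ => ?_) ⟨i, Finset.mem_univ i, ?_⟩
    · rcases lt_trichotomy j i with hj | rfl | hj
      · have := hfib j
        have := hlt j hj
        omega
      · have := hfib j
        omega
      · rw [Finset.sum_eq_zero]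
        · exact Nat.zero_le _
        · intro p _
          by_cases hp : A p = 0
          · rw [hp, zero_mul]
          · rw [h p hp j hj, mul_zero]
    · have := hfib i
      omega
  simp only [Finset.mul_sum] at hdeg
  rw [Finset.sum_comm, hdeg, Finset.sum_comm] at hsum
  exact lt_irrefl _ hsum

lemma finsupp_eq_of_le_of_degree_eq {V : Type*} {a b : V →₀ ℕ} (h : a ≤ b)
    (hd : a.degree = b.degree) : a = b := by
  obtain ⟨c, rfl⟩ := exists_add_of_le h
  rw [map_add, left_eq_add, Finsupp.degree_eq_zero_iff] at hd
  rw [hd, add_zero]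

/-- A strongly stable ideal generated in one degree: moving a variable of a generator to a smaller
index gives a generator again. -/
lemma StronglyStable.exists_exchange {n : ℕ} {K J : Type*} [Field K]
    {I : Ideal (MvPolynomial (Fin n) K)} (hI : StronglyStable I) {d : ℕ} {u : J → (Fin n →₀ ℕ)}
    (hdeg : ∀ k, (u k).degree = d)
    (hspan : I = Ideal.span (Set.range fun k => MvPolynomial.monomial (u k) (1 : K)))
    {k : J} {i j : Fin n} (hij : i < j) (hj : u k j ≠ 0) :
    ∃ k', Finsupp.single i 1 + u k = Finsupp.single j 1 + u k' := by
  classical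
  have hle : Finsupp.single j 1 ≤ u k := by
    rw [Finsupp.single_le_iff]
    omega
  have heq : u k - Finsupp.single j 1 + Finsupp.single j 1 = u k := tsub_add_cancel_of_le hle
  have hk : MvPolynomial.monomial (u k) (1 : K) ∈ I := by
    rw [hspan]
    exact Ideal.subset_span ⟨k, rfl⟩
  have hmem := hI.2 (u k) hk j i hij hj
  have hrange : (Set.range fun k => MvPolynomial.monomial (u k) (1 : K)) =
      (fun m => MvPolynomial.monomial m (1 : K)) '' Set.range u := by
    rw [← Set.range_comp]
    rfl
  rw [hspan, hrange, MvPolynomial.mem_ideal_span_monomial_image,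
    MvPolynomial.support_monomial, if_neg one_ne_zero] at hmem
  obtain ⟨_, ⟨k', rfl⟩, hk'⟩ := hmem _ (Finset.mem_singleton_self _)
  refine ⟨k', ?_⟩
  have hdegree := congrArg Finsupp.degree heq
  rw [map_add, Finsupp.degree_single, hdeg k] at hdegree
  rw [finsupp_eq_of_le_of_degree_eq hk' (by
    rw [map_add, Finsupp.degree_single, hdeg k', hdegree])]
  rw [add_comm (Finsupp.single j 1), add_right_comm, heq, add_comm]

/-- If `G` is a Gröbner basis (with respect to some monomial order, with
marked terms as initial terms) of the toric ideal `ker φ'` of the special fiber of a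
collection of strongly stable ideals `I_1, …, I_r`, each generated in a single degree,
then there is a monomial order on `S[T_{i,j}]` for which
`G' = {x_i T_{l,k} − x_j T_{l,k'} : i < j, x_i u_{l,k} = x_j u_{l,k'}} ∪ G` is a Gröbner
basis of the defining ideal `ker φ` of the multi-Rees algebra, with the marked terms as
initial terms. -/
theorem multiRees_fiber_type_GB {n r : ℕ} {K : Type} [Field K]
    (s : Fin r → ℕ) (d : Fin r → ℕ)
    (u : (i : Fin r) → Fin (s i) → (Fin n →₀ ℕ))
    (hdeg : ∀ i j, ((u i j).sum fun _ e => e) = d i)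
    (hmin : ∀ i, Function.Injective (u i))
    (I : Fin r → Ideal (MvPolynomial (Fin n) K))
    (hI : ∀ i, I i = Ideal.span (Set.range fun j => (MvPolynomial.monomial (u i j) (1 : K))))
    (hSS : ∀ i, StronglyStable (I i))
    (φ : MvPolynomial (Fin n ⊕ ((i : Fin r) × Fin (s i))) K →ₐ[K]
      MvPolynomial (Fin n ⊕ Fin r) K)
    (hφ : φ = MvPolynomial.aeval (Sum.elim
      (fun i => (MvPolynomial.X (Sum.inl i) : MvPolynomial (Fin n ⊕ Fin r) K))
      (fun p => MvPolynomial.monomial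
        (Finsupp.mapDomain Sum.inl (u p.1 p.2) + Finsupp.single (Sum.inr p.1) 1) 1)))
    (φ' : MvPolynomial ((i : Fin r) × Fin (s i)) K →ₐ[K] MvPolynomial (Fin n ⊕ Fin r) K)
    (hφ' : φ' = MvPolynomial.aeval (fun p => MvPolynomial.monomial
      (Finsupp.mapDomain Sum.inl (u p.1 p.2) + Finsupp.single (Sum.inr p.1) 1) 1))
    (G : Finset (MarkedBinomial ((i : Fin r) × Fin (s i))))
    (hG : ∃ ord : MonomialOrd ((i : Fin r) × Fin (s i)),
      IsMarkedGB ord.gt (G : Set (MarkedBinomial ((i : Fin r) × Fin (s i))))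
        (RingHom.ker φ'.toRingHom)) :
    ∃ ord' : MonomialOrd (Fin n ⊕ ((i : Fin r) × Fin (s i))),
      IsMarkedGB ord'.gt
        ({g : MarkedBinomial (Fin n ⊕ ((i : Fin r) × Fin (s i))) |
            ∃ (i j : Fin n) (l : Fin r) (k k' : Fin (s l)), i < j ∧
              Finsupp.single i 1 + u l k = Finsupp.single j 1 + u l k' ∧
              g.head = Finsupp.single (Sum.inl i) 1 + Finsupp.single (Sum.inr ⟨l, k⟩) 1 ∧
              g.tail = Finsupp.single (Sum.inl j) 1 + Finsupp.single (Sum.inr ⟨l, k'⟩) 1}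
          ∪ (MarkedBinomial.map Sum.inr '' (G : Set (MarkedBinomial ((i : Fin r) × Fin (s i))))))
        (RingHom.ker φ.toRingHom) := by
  classical
  have hdegree : ∀ i j, (u i j).degree = d i := hdeg
  have hsumdeg : ∀ p : (i : Fin r) × Fin (s i), ∑ x, u p.1 p.2 x = d p.1 := fun p => by
    rw [← hdegree p.1 p.2, Finsupp.degree_eq_sum]
  set w' : ((i : Fin r) × Fin (s i)) → (Fin n ⊕ Fin r →₀ ℕ) := fun p =>
    Finsupp.mapDomain Sum.inl (u p.1 p.2) + Finsupp.single (Sum.inr p.1) 1 with hw'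
  set w : Fin n ⊕ ((i : Fin r) × Fin (s i)) → (Fin n ⊕ Fin r →₀ ℕ) :=
    Sum.elim (fun i => Finsupp.single (Sum.inl i) 1) w' with hw
  have hwinl : ∀ p x, w' p (Sum.inl x) = u p.1 p.2 x := fun p x => by
    simp [hw', Finsupp.mapDomain_apply Sum.inl_injective]
  have hwinr : ∀ p l, w' p (Sum.inr l) = if p.1 = l then 1 else 0 := fun p l => by
    simp [hw', Finsupp.mapDomain_of_notMem_range, Finsupp.single_apply]
  have hφw : φ = MvPolynomial.aeval fun v => MvPolynomial.monomial (w v) (1 : K) := by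
    rw [hφ]
    congr 1
    ext1 (i | p) <;> rfl
  obtain ⟨ord, hord⟩ := hG
  rw [hφ', isMarkedGB_toric_iff w' ord.irrefl] at hord
  obtain ⟨hker, hgt, hdiv⟩ := hord
  refine ⟨(MonomialOrd.lex (Fin n)).block ord, ?_⟩
  rw [hφw, isMarkedGB_toric_iff w (MonomialOrd.irrefl _)]
  refine ⟨?_, ?_, ?_⟩
  · rintro g (⟨i, j, l, k, k', -, heq, hh, ht⟩ | ⟨g, hg, rfl⟩)
    · rw [hh, ht]
      have h := congrArg (Finsupp.mapDomain (Sum.inl : Fin n → Fin n ⊕ Fin r)) heq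
      simp only [Finsupp.mapDomain_add, Finsupp.mapDomain_single] at h
      simp only [fiberMap_eq_linearCombination, map_add, Finsupp.linearCombination_single,
        one_smul, hw, hw', Sum.elim_inl, Sum.elim_inr]
      rw [← add_assoc, h, add_assoc]
    · simp only [MarkedBinomial.map, fiberMap_mapDomain_inr]
      exact hker g hg
  · rintro g (⟨i, j, l, k, k', hij, -, hh, ht⟩ | ⟨g, hg, rfl⟩)
    · left
      rw [hh, ht]
      refine ⟨i, fun x hx => ?_, ?_⟩
      · simp [hx.ne', (hx.trans hij).ne']
      · simp [hij.ne]
    · refine Or.inr ⟨?_, ?_⟩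
      · ext x
        simp [MarkedBinomial.map, Finsupp.mapDomain_of_notMem_range]
      · convert hgt g hg using 1 <;>
        · ext x
          simp [MarkedBinomial.map, Finsupp.mapDomain_apply Sum.inr_injective]
  · intro m m' hmm' hfib
    have hinl : ∀ x, m (Sum.inl x) + ∑ p, m (Sum.inr p) * u p.1 p.2 x =
        m' (Sum.inl x) + ∑ p, m' (Sum.inr p) * u p.1 p.2 x := fun x => by
      have h := DFunLike.congr_fun hfib (Sum.inl x)
      simpa [fiberMap_apply, hw, hwinl, Finsupp.single_apply] using h
    have hinr : ∀ l, ∑ p : (i : Fin r) × Fin (s i), m (Sum.inr p) * (if p.1 = l then 1 else 0) =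
        ∑ p : (i : Fin r) × Fin (s i), m' (Sum.inr p) * (if p.1 = l then 1 else 0) := fun l => by
      have h := DFunLike.congr_fun hfib (Sum.inr l)
      simpa [fiberMap_apply, hw, hwinr, Finsupp.single_apply] using h
    rcases hmm' with ⟨i, hlt, hi⟩ | ⟨heq, hlt⟩
    · have htotal : ∀ A : ((i : Fin r) × Fin (s i)) → ℕ, ∑ p, A p * ∑ x, u p.1 p.2 x =
          ∑ l, d l * ∑ p : (i : Fin r) × Fin (s i), A p * (if p.1 = l then 1 else 0) := by
        intro A
        simp only [Finset.mul_sum]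
        rw [Finset.sum_comm (s := (Finset.univ : Finset (Fin r)))]
        refine Finset.sum_congr rfl fun p _ => ?_
        rw [← Finset.mul_sum, hsumdeg]
        simp [mul_comm]
      obtain ⟨⟨l, k⟩, hp, j, hij, hj⟩ := exists_factor_of_lex_lt
        (fun (p : (i : Fin r) × Fin (s i)) x => u p.1 p.2 x)
        (a := fun x => m (Sum.inl x)) (b := fun x => m' (Sum.inl x))
        (A := fun p => m (Sum.inr p)) (B := fun p => m' (Sum.inr p)) hinl
        (by rw [htotal, htotal]; simp only [hinr]) hi hlt
      obtain ⟨k', hk'⟩ := (hSS l).exists_exchange (hdegree l) (hI l) hij hj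
      refine ⟨⟨_, _⟩, Or.inl ⟨i, j, l, k, k', hij, hk', rfl, rfl⟩, ?_⟩
      have hi' : m' (Sum.inl i) < m (Sum.inl i) := hi
      rintro (x | p)
      · by_cases hx : x = i
        · subst hx
          simp
          omega
        · simp [Ne.symm hx]
      · by_cases hx : p = ⟨l, k⟩
        · subst hx
          simp
          omega
        · simp [Ne.symm hx]
    · have heq' : ∀ x, m (Sum.inl x) = m' (Sum.inl x) := fun x => DFunLike.congr_fun heq x
      obtain ⟨g, hg, hle⟩ := hdiv _ _ hlt (by
        ext (x | l)
        · have := hinl x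
          rw [heq' x] at this
          simpa [fiberMap_apply, hwinl] using this
        · simpa [fiberMap_apply, hwinr] using hinr l)
      refine ⟨_, Or.inr ⟨g, hg, rfl⟩, ?_⟩
      rintro (x | p)
      · simp [MarkedBinomial.map, Finsupp.mapDomain_of_notMem_range]
      · simpa [MarkedBinomial.map, Finsupp.mapDomain_apply Sum.inr_injective] using hle p
end

section
/- Let G = {g_1, …, g_s} be a finite collection of marked binomials in a polynomial ring K[x_1, …, x_n] over a field K, all homogeneous of the same degree d, where g_i = u_{i,1} − u_{i,2} is marked at u_{i,1}. Then the following are equivalent: (1) for every monomial μ, the directed graph Γ_μ(G) has a unique sink and no directed cycles; (2) there exists a monomial order <_τ on K[x_1, …, x_n] such that the <_τ-initial term of g_i is u_{i,1} for every i and G is a Gröbner basis of the ideal ⟨g_1, …, g_s⟩ with respect to <_τ. -/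
/-- In a torsion-free abelian group, every pointed submonoid extends to a pointed submonoid that
contains each element or its negative. -/
theorem AddSubmonoid.exists_le_pointed_total {A : Type*} [AddCommGroup A] [IsAddTorsionFree A]
    (C : AddSubmonoid A) (hC : ∀ a ∈ C, -a ∈ C → a = 0) :
    ∃ S : AddSubmonoid A, C ≤ S ∧ (∀ a ∈ S, -a ∈ S → a = 0) ∧ ∀ a, a ∈ S ∨ -a ∈ S := by
  obtain ⟨S, hCS, hS⟩ := zorn_le_nonempty₀
    {T : AddSubmonoid A | ∀ a ∈ T, -a ∈ T → a = 0} (by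
      intro c hc hchain y hy
      refine ⟨sSup c, ?_, fun z hz => le_sSup hz⟩
      intro a ha hna
      rw [AddSubmonoid.mem_sSup_of_directedOn ⟨y, hy⟩ hchain.directedOn] at ha hna
      obtain ⟨T, hT, haT⟩ := ha
      obtain ⟨T', hT', haT'⟩ := hna
      rcases hchain.total hT hT' with h | h
      · exact hc hT' a (h haT) haT'
      · exact hc hT a haT (h haT')) C hC
  have hpt : ∀ a ∈ S, -a ∈ S → a = 0 := hS.prop
  have key : ∀ a, a ∉ S → ∃ k : ℕ, k ≠ 0 ∧ -(k • a) ∈ S := by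
    intro a ha
    by_contra! hk
    refine ha (hS.le_of_ge (y := S ⊔ AddSubmonoid.multiples a) ?_ le_sup_left
      (AddSubmonoid.mem_sup_right (AddSubmonoid.mem_multiples a)))
    intro b hb hnb
    simp only [AddSubmonoid.mem_sup, AddSubmonoid.mem_multiples_iff] at hb hnb
    obtain ⟨s, hs, _, ⟨k, rfl⟩, rfl⟩ := hb
    obtain ⟨t, ht, _, ⟨l, rfl⟩, hst⟩ := hnb
    have hneg : -((k + l) • a) = s + t := by
      rw [add_smul, neg_eq_iff_add_eq_zero]
      calc _ = (s + k • a) + (t + l • a) := by abel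
        _ = 0 := by rw [hst, add_neg_cancel]
    have hkl : k + l = 0 := by
      by_contra h
      exact hk _ h (hneg ▸ S.add_mem hs ht)
    obtain ⟨rfl, rfl⟩ : k = 0 ∧ l = 0 := by omega
    simp only [zero_smul, add_zero] at hst ⊢
    exact hpt s hs (hst ▸ ht)
  refine ⟨S, hCS, hpt, fun a => ?_⟩
  by_contra! h
  obtain ⟨k, hk, hka⟩ := key a h.1
  obtain ⟨l, hl, hla⟩ := key (-a) h.2
  have hpos : (k * l) • a ∈ S := by
    rw [mul_smul]
    refine S.nsmul_mem ?_ k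
    simpa using hla
  have hneg : -((k * l) • a) ∈ S := by
    rw [mul_comm, mul_smul, ← smul_neg]
    exact S.nsmul_mem hka l
  have h0 := hpt _ hpos hneg
  rw [smul_eq_zero_iff_right (mul_ne_zero hk hl)] at h0
  exact h.1 (h0 ▸ S.zero_mem)

section Reduction

open Relation

variable {V : Type*} {G : Set (MarkedBinomial V)}

theorem reduces_add_head_tail {g : MarkedBinomial V} (hg : g ∈ G) (a : V →₀ ℕ) :
    Reduces G (a + g.head) (a + g.tail) :=
  ⟨g, hg, le_add_self, by rw [add_tsub_cancel_right]⟩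

theorem reduces_iff_exists_add {m m' : V →₀ ℕ} :
    Reduces G m m' ↔ ∃ g ∈ G, ∃ a, m = a + g.head ∧ m' = a + g.tail := by
  constructor
  · rintro ⟨g, hg, hle, rfl⟩
    exact ⟨g, hg, m - g.head, (tsub_add_cancel_of_le hle).symm, rfl⟩
  · rintro ⟨g, hg, a, rfl, rfl⟩
    exact reduces_add_head_tail hg a

theorem Reduces.add_right {m m' : V →₀ ℕ} (q : V →₀ ℕ) (h : Reduces G m m') :
    Reduces G (m + q) (m' + q) := by
  obtain ⟨g, hg, a, rfl, rfl⟩ := reduces_iff_exists_add.1 h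
  exact reduces_iff_exists_add.2 ⟨g, hg, a + q, add_right_comm .., add_right_comm ..⟩

theorem forall_not_reduces_iff {m : V →₀ ℕ} :
    (∀ w, ¬ Reduces G m w) ↔ ∀ g ∈ G, ¬ g.head ≤ m :=
  ⟨fun h g hg hle => h _ ⟨g, hg, hle, rfl⟩, fun h _ ⟨g, hg, hle, _⟩ => h g hg hle⟩

theorem reflTransGen_reduces_add_right {m m' : V →₀ ℕ} (q : V →₀ ℕ)
    (h : ReflTransGen (Reduces G) m m') : ReflTransGen (Reduces G) (m + q) (m' + q) :=
  ReflTransGen.lift (· + q) (fun _ _ h => h.add_right q) _ _ h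

theorem transGen_reduces_add_right {m m' : V →₀ ℕ} (q : V →₀ ℕ)
    (h : TransGen (Reduces G) m m') : TransGen (Reduces G) (m + q) (m' + q) :=
  TransGen.lift (· + q) (fun _ _ h => h.add_right q) _ _ h

theorem reflTransGen_reduces_degree (hG : ∀ g ∈ G, g.head.degree = g.tail.degree)
    {m m' : V →₀ ℕ} (h : ReflTransGen (Reduces G) m m') : m.degree = m'.degree := by
  induction h with
  | refl => rfl
  | tail _ h ih =>
    obtain ⟨g, hg, a, rfl, rfl⟩ := reduces_iff_exists_add.1 h
    rw [ih, map_add, map_add, hG g hg]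

/-- The additive embedding of exponent vectors into integer vectors. -/
def intExponents : (V →₀ ℕ) →+ (V → ℤ) where
  toFun m i := m i
  map_zero' := by ext; simp
  map_add' := by intros; ext; simp

theorem intExponents_injective : Function.Injective (intExponents (V := V)) := by
  intro a b h
  ext i
  exact Int.ofNat.inj (congrFun h i)

/-- The submonoid of integer vectors generated by the differences of monomials along reductions
together with the nonnegative vectors. -/
def reductionCone (G : Set (MarkedBinomial V)) : AddSubmonoid (V → ℤ) where
  carrier := {z | ∃ m m' p, ReflTransGen (Reduces G) m m' ∧
    z + intExponents m' = intExponents (m + p)}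
  zero_mem' := ⟨0, 0, 0, .refl, by simp⟩
  add_mem' := by
    rintro y z ⟨m, m', p, h, hy⟩ ⟨q, q', r, h', hz⟩
    refine ⟨m + q, m' + q', p + r, (reflTransGen_reduces_add_right q h).trans ?_, ?_⟩
    · simpa only [add_comm m'] using reflTransGen_reduces_add_right m' h'
    · calc y + z + intExponents (m' + q')
          = (y + intExponents m') + (z + intExponents q') := by rw [map_add]; abel
        _ = _ := by rw [hy, hz]; simp only [map_add]; abel

theorem reductionCone_pointed (hG : ∀ g ∈ G, g.head.degree = g.tail.degree)
    (hacyc : ∀ m, ¬ TransGen (Reduces G) m m) {z : V → ℤ}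
    (hz : z ∈ reductionCone G) (hnz : -z ∈ reductionCone G) : z = 0 := by
  obtain ⟨m, m', p, h, hz⟩ := hz
  obtain ⟨q, q', r, h', hnz⟩ := hnz
  have hsum : m' + q' = m + q + (p + r) := intExponents_injective <|
    calc intExponents (m' + q') = (z + intExponents m') + (-z + intExponents q') := by
          rw [map_add]; abel
      _ = _ := by rw [hz, hnz]; simp only [map_add]; abel
  have hdeg := congrArg Finsupp.degree hsum
  have h1 := reflTransGen_reduces_degree hG h
  have h2 := reflTransGen_reduces_degree hG h'
  simp only [map_add] at hdeg
  have hp : p = 0 := (Finsupp.degree_eq_zero_iff p).1 (by omega)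
  have hr : r = 0 := (Finsupp.degree_eq_zero_iff r).1 (by omega)
  subst hp hr
  simp only [add_zero] at hsum hz
  rcases reflTransGen_iff_eq_or_transGen.1 h with rfl | ht
  · simpa using hz
  · refine absurd ((transGen_reduces_add_right q ht).trans_left ?_) (hacyc (m + q))
    rw [← hsum]
    simpa only [add_comm m'] using reflTransGen_reduces_add_right m' h'

/-- If the differences of exponent vectors lie in a total pointed submonoid containing the
nonnegative vectors, then this submonoid defines a monomial order. -/
def MonomialOrd.ofTotalSubmonoid (S : AddSubmonoid (V → ℤ)) (hpt : ∀ a ∈ S, -a ∈ S → a = 0)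
    (htot : ∀ a, a ∈ S ∨ -a ∈ S) (hnonneg : ∀ m : V →₀ ℕ, intExponents m ∈ S) :
    MonomialOrd V where
  gt a b := a ≠ b ∧ intExponents a - intExponents b ∈ S
  irrefl _ h := h.1 rfl
  trans := by
    rintro a b c ⟨hab, h1⟩ ⟨hbc, h2⟩
    refine ⟨?_, by simpa using S.add_mem h1 h2⟩
    rintro rfl
    exact hab (intExponents_injective (sub_eq_zero.1 (hpt _ h1 (by simpa using h2))))
  total a b hab := by
    rcases htot (intExponents a - intExponents b) with h | h
    · exact .inl ⟨hab, h⟩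
    · exact .inr ⟨hab.symm, by simpa using h⟩
  add_right := by
    rintro a b c ⟨hab, h⟩
    exact ⟨by simpa using hab, by simpa using h⟩
  gt_zero m hm := ⟨hm, by simpa using hnonneg m⟩

/-- If reduction along homogeneous marked binomials is acyclic, then some monomial order selects
the marked terms. -/
theorem exists_monomialOrd_of_acyclic (hG : ∀ g ∈ G, g.head.degree = g.tail.degree)
    (hacyc : ∀ m, ¬ TransGen (Reduces G) m m) :
    ∃ ord : MonomialOrd V, ∀ g ∈ G, ord.gt g.head g.tail := by
  obtain ⟨S, hCS, hpt, htot⟩ := (reductionCone G).exists_le_pointed_total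
    fun _ h h' => reductionCone_pointed hG hacyc h h'
  refine ⟨.ofTotalSubmonoid S hpt htot fun m => hCS ⟨0, 0, m, .refl, by simp⟩, fun g hg => ?_⟩
  have hred : Reduces G g.head g.tail := by simpa using reduces_add_head_tail hg 0
  refine ⟨fun h => hacyc g.head (.single (h ▸ hred)), hCS ⟨_, _, 0, .single hred, by simp⟩⟩

theorem Reduces.gt {ord : MonomialOrd V} (hord : ∀ g ∈ G, ord.gt g.head g.tail)
    {m m' : V →₀ ℕ} (h : Reduces G m m') : ord.gt m m' := by
  obtain ⟨g, hg, a, rfl, rfl⟩ := reduces_iff_exists_add.1 h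
  simpa only [add_comm a] using ord.add_right a (hord g hg)

theorem transGen_reduces_gt {ord : MonomialOrd V} (hord : ∀ g ∈ G, ord.gt g.head g.tail)
    {m m' : V →₀ ℕ} (h : TransGen (Reduces G) m m') : ord.gt m m' := by
  induction h with
  | single h => exact h.gt hord
  | tail _ h ih => exact ord.trans ih (h.gt hord)

/-- Reduction in finitely many variables that preserves degree and decreases a monomial order
reaches a sink. -/
theorem exists_sink [Finite V] (hG : ∀ g ∈ G, g.head.degree = g.tail.degree)
    {ord : MonomialOrd V} (hord : ∀ g ∈ G, ord.gt g.head g.tail) (μ : V →₀ ℕ) :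
    ∃ ν, ReflTransGen (Reduces G) μ ν ∧ ∀ w, ¬ Reduces G ν w := by
  have : Finite {ν : V →₀ ℕ // ν.degree = μ.degree} :=
    (Finsupp.finite_of_degree_eq μ.degree).to_subtype
  let r : {ν : V →₀ ℕ // ν.degree = μ.degree} → {ν : V →₀ ℕ // ν.degree = μ.degree} → Prop :=
    fun a b => ord.gt b a
  have : IsTrans _ r := ⟨fun _ _ _ h h' => ord.trans h' h⟩
  have : Std.Irrefl r := ⟨fun _ => ord.irrefl _⟩
  obtain ⟨ν, hν, hmin⟩ := (Finite.wellFounded_of_trans_of_irrefl r).has_min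
    {ν | ReflTransGen (Reduces G) μ ν} ⟨⟨μ, rfl⟩, .refl⟩
  refine ⟨ν, hν, fun w hw => ?_⟩
  have hμw : ReflTransGen (Reduces G) μ w := hν.tail hw
  exact hmin ⟨w, (reflTransGen_reduces_degree hG hμw).symm⟩ hμw (hw.gt hord)

end Reduction

section Ideal

variable {V K : Type*} [Field K] {G : Set (MarkedBinomial V)}

open MvPolynomial Relation

theorem monomial_sub_monomial_mem_span {m m' : V →₀ ℕ} (h : ReflTransGen (Reduces G) m m') :
    (monomial m 1 - monomial m' 1 : MvPolynomial V K) ∈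
      Ideal.span ((fun g => g.toPoly K) '' G) := by
  induction h with
  | refl => simp
  | tail _ h ih =>
    obtain ⟨g, hg, a, rfl, rfl⟩ := reduces_iff_exists_add.1 h
    rw [← sub_add_sub_cancel]
    refine add_mem ih ?_
    have : (monomial (a + g.head) 1 - monomial (a + g.tail) 1 : MvPolynomial V K) =
        monomial a 1 * g.toPoly K := by
      simp [MarkedBinomial.toPoly, mul_sub, monomial_mul]
    rw [this]
    exact Ideal.mul_mem_left _ _ (Ideal.subset_span ⟨g, hg, rfl⟩)

theorem coeff_monomial_sub_monomial_ne_zero {a b : V →₀ ℕ} (hab : a ≠ b) :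
    coeff a (monomial a 1 - monomial b 1 : MvPolynomial V K) ≠ 0 := by
  classical
  simp [coeff_monomial, hab.symm]

theorem isInitialTerm_monomial_sub_monomial {ord : MonomialOrd V} {a b : V →₀ ℕ}
    (h : ord.gt a b) :
    IsInitialTerm ord.gt (monomial a 1 - monomial b 1 : MvPolynomial V K) a := by
  classical
  have hab : a ≠ b := fun e => ord.irrefl b (e ▸ h)
  refine ⟨mem_support_iff.2 (coeff_monomial_sub_monomial_ne_zero hab), fun m hm hma => ?_⟩
  rw [mem_support_iff, coeff_sub, coeff_monomial, coeff_monomial, if_neg hma.symm] at hm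
  have : b = m := by
    by_contra hbm
    simp [hbm] at hm
  exact this ▸ h

/-- Distinct sinks are not congruent modulo an ideal with the given marked Gröbner basis. -/
theorem IsMarkedGB.sink_eq {ord : MonomialOrd V} {J : Ideal (MvPolynomial V K)}
    (hGB : IsMarkedGB ord.gt G J) {ν ν' : V →₀ ℕ} (hν : ∀ w, ¬ Reduces G ν w)
    (hν' : ∀ w, ¬ Reduces G ν' w) (hmem : monomial ν 1 - monomial ν' 1 ∈ J) : ν = ν' := by
  by_contra hne
  wlog hgt : ord.gt ν ν' generalizing ν ν'
  · refine this hν' hν ?_ (Ne.symm hne) ((ord.total _ _ hne).resolve_left hgt)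
    simpa using J.neg_mem hmem
  have hf : (monomial ν 1 - monomial ν' 1 : MvPolynomial V K) ≠ 0 := fun h0 =>
    coeff_monomial_sub_monomial_ne_zero (K := K) hne (by rw [h0, coeff_zero])
  have hin := hGB.2.2.ge (Ideal.subset_span
    ⟨_, hmem, hf, ν, isInitialTerm_monomial_sub_monomial hgt, rfl⟩)
  have himage : (fun g : MarkedBinomial V => monomial g.head (1 : K)) '' G =
      (fun m => monomial m (1 : K)) '' (MarkedBinomial.head '' G) := by
    rw [Set.image_image]
  rw [himage, mem_ideal_span_monomial_image] at hin
  obtain ⟨_, ⟨g, hg, rfl⟩, hle⟩ := hin ν (by classical simp [mem_support_iff, coeff_monomial])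
  exact forall_not_reduces_iff.1 hν g hg hle

/-- If a map of monomials is constant along reductions, then its linear extension vanishes on
the ideal of the binomials. -/
theorem linearExtension_eq_zero {nf : (V →₀ ℕ) → (V →₀ ℕ)}
    (hnf : ∀ m m', Reduces G m m' → nf m = nf m') {f : MvPolynomial V K}
    (hf : f ∈ Ideal.span ((fun g => g.toPoly K) '' G)) :
    (f.support.sum fun m => monomial (nf m) (coeff m f)) = 0 := by
  let φ : MvPolynomial V K →ₗ[K] MvPolynomial V K :=
    (basisMonomials V K).constr K fun m => monomial (nf m) 1
  have hφ (m : V →₀ ℕ) (c : K) : φ (monomial m c) = monomial (nf m) c := by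
    have h : φ (monomial m 1) = monomial (nf m) 1 := by
      simpa using (basisMonomials V K).constr_basis K
        (fun m => (monomial (nf m) 1 : MvPolynomial V K)) m
    have hc : ∀ k : V →₀ ℕ, (monomial k c : MvPolynomial V K) = c • monomial k 1 := by
      intro k; simp [smul_monomial]
    rw [hc, map_smul, h, ← hc]
  have hmul : ∀ p : MvPolynomial V K, φ (p * f) = 0 := by
    induction hf using Submodule.span_induction with
    | mem x hx =>
      obtain ⟨g, hg, rfl⟩ := hx
      intro p
      induction p using MvPolynomial.induction_on' with
      | monomial a c =>
        simp [MarkedBinomial.toPoly, mul_sub, monomial_mul, hφ,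
          hnf _ _ (reduces_add_head_tail hg a)]
      | add p q hp hq => rw [add_mul, map_add, hp, hq, add_zero]
    | zero => simp
    | add x y _ _ hx hy => intro p; rw [mul_add, map_add, hx, hy, add_zero]
    | smul q x _ ih => intro p; rw [smul_eq_mul, ← mul_assoc]; exact ih _
  have hzero : φ f = 0 := by simpa using hmul 1
  rw [← hzero]
  conv_rhs => rw [f.as_sum, map_sum]
  simp only [hφ]

/-- If every monomial has a unique sink, then the initial term of a nonzero element of the ideal
of the binomials is divisible by a marked term. -/
theorem exists_head_le_of_isInitialTerm {ord : MonomialOrd V}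
    (hord : ∀ g ∈ G, ord.gt g.head g.tail)
    (hsink : ∀ μ : V →₀ ℕ, ∃! ν, ReflTransGen (Reduces G) μ ν ∧ ∀ w, ¬ Reduces G ν w)
    {f : MvPolynomial V K} (hf : f ∈ Ideal.span ((fun g => g.toPoly K) '' G)) {m : V →₀ ℕ}
    (hm : IsInitialTerm ord.gt f m) : ∃ g ∈ G, g.head ≤ m := by
  classical
  by_contra! hno
  have hm_sink : ∀ w, ¬ Reduces G m w := forall_not_reduces_iff.2 hno
  choose nf hnf huniq using hsink
  have hstep : ∀ a b, Reduces G a b → nf a = nf b := fun a b hab =>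
    (huniq a (nf b) ⟨(hnf b).1.head hab, (hnf b).2⟩).symm
  have hsum := congrArg (coeff m) (linearExtension_eq_zero hstep hf)
  rw [coeff_sum, Finset.sum_eq_single_of_mem m hm.1, coeff_monomial,
    if_pos (huniq m m ⟨.refl, hm_sink⟩).symm, coeff_zero] at hsum
  · exact mem_support_iff.1 hm.1 hsum
  · intro b hb hbm
    rw [coeff_monomial, if_neg]
    intro hbn
    have hgt := hm.2 b hb hbm
    rcases reflTransGen_iff_eq_or_transGen.1 (hnf b).1 with h | h
    · exact hbm (h.symm.trans hbn)
    · exact ord.irrefl m (ord.trans hgt (hbn ▸ transGen_reduces_gt hord h))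

/-- If every monomial has a unique sink, then the marked binomials form a Gröbner basis of the
ideal they generate. -/
theorem isMarkedGB_span_of_existsUnique_sink {ord : MonomialOrd V}
    (hord : ∀ g ∈ G, ord.gt g.head g.tail)
    (hsink : ∀ μ : V →₀ ℕ, ∃! ν, ReflTransGen (Reduces G) μ ν ∧ ∀ w, ¬ Reduces G ν w) :
    IsMarkedGB ord.gt G (Ideal.span ((fun g => g.toPoly K) '' G)) := by
  have hmem : ∀ g ∈ G, g.toPoly K ∈ Ideal.span ((fun g => g.toPoly K) '' G) :=
    fun g hg => Ideal.subset_span ⟨g, hg, rfl⟩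
  refine ⟨hmem, hord, le_antisymm (Ideal.span_mono ?_) (Ideal.span_le.2 ?_)⟩
  · rintro _ ⟨g, hg, rfl⟩
    have hin : IsInitialTerm ord.gt (g.toPoly K) g.head :=
      isInitialTerm_monomial_sub_monomial (hord g hg)
    exact ⟨_, hmem g hg, support_nonempty.1 ⟨_, hin.1⟩, g.head, hin, rfl⟩
  · rintro _ ⟨f, hf, -, m, hm, rfl⟩
    obtain ⟨g, hg, hle⟩ := exists_head_le_of_isInitialTerm hord hsink hf hm
    refine Ideal.mem_of_dvd _ ?_ (Ideal.subset_span ⟨g, hg, rfl⟩)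
    exact monomial_dvd_monomial.2 ⟨.inr hle, dvd_rfl⟩

end Ideal


/-- For a finite collection `G` of marked binomials, all homogeneous of
the same degree `d`, the following are equivalent: (1) for every monomial `μ` the
directed graph `Γ_μ(G)` (vertices: monomials reachable from `μ` by one-step reductions;
edges: one-step reductions) has a unique sink and no directed cycles; (2) there is a
monomial order for which the marked terms are the initial terms and `G` is a Gröbner
basis of the ideal it generates. -/
theorem directed_graph_iff_GroebnerBasis {n : ℕ} {K : Type} [Field K] (d : ℕ)
    (G : Finset (MarkedBinomial (Fin n)))
    (hG : ∀ g ∈ G, g.head ≠ g.tail ∧ (g.head.sum fun _ e => e) = d ∧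
      (g.tail.sum fun _ e => e) = d) :
    ((∀ μ : Fin n →₀ ℕ,
        (∃! ν : Fin n →₀ ℕ,
          Relation.ReflTransGen (Reduces (G : Set (MarkedBinomial (Fin n)))) μ ν ∧
            ∀ w, ¬ Reduces (G : Set (MarkedBinomial (Fin n))) ν w) ∧
        (∀ ν : Fin n →₀ ℕ,
          Relation.ReflTransGen (Reduces (G : Set (MarkedBinomial (Fin n)))) μ ν →
            ¬ Relation.TransGen (Reduces (G : Set (MarkedBinomial (Fin n)))) ν ν)) ↔
      (∃ ord : MonomialOrd (Fin n),
        IsMarkedGB ord.gt (G : Set (MarkedBinomial (Fin n)))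
          (Ideal.span ((fun g => g.toPoly K) '' (G : Set (MarkedBinomial (Fin n))))))) := by
  have hdeg : ∀ g ∈ (G : Set (MarkedBinomial (Fin n))), g.head.degree = g.tail.degree :=
    fun g hg => (hG g hg).2.1.trans (hG g hg).2.2.symm
  constructor
  · intro h
    obtain ⟨ord, hord⟩ := exists_monomialOrd_of_acyclic hdeg fun m => (h m).2 m .refl
    exact ⟨ord, isMarkedGB_span_of_existsUnique_sink hord fun μ => (h μ).1⟩
  · rintro ⟨ord, hGB⟩ μ
    obtain ⟨ν, hν⟩ := exists_sink hdeg hGB.2.1 μ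
    refine ⟨⟨ν, hν, fun ν' hν' => hGB.sink_eq hν'.2 hν.2 ?_⟩,
      fun m _ hm => ord.irrefl m (transGen_reduces_gt hGB.2.1 hm)⟩
    simpa using sub_mem (monomial_sub_monomial_mem_span (K := K) hν.1)
      (monomial_sub_monomial_mem_span (K := K) hν'.1)
end

section
/- Let I_1, …, I_r be strongly stable ideals in S = K[x_1, …, x_n], each I_i minimally generated by monomials u_{i,1}, …, u_{i,s_i} all of degree d_i, and let φ' : K[T_{i,j}] → K[x_1, …, x_n, t_1, …, t_r] be the K-algebra map T_{i,j} ↦ u_{i,j}·t_i. Suppose G is a finite set of marked binomials which is a Gröbner basis of ker φ' with respect to some monomial order on K[T_{i,j}], with the marked terms as initial terms. Then the collection of marked binomials G' = { x_i·T_{l,k} − x_j·T_{l,k'} : i < j and x_i·u_{l,k} = x_j·u_{l,k'} } ∪ G, with each x_i·T_{l,k} − x_j·T_{l,k'} marked at x_i·T_{l,k}, defines a Noetherian reduction relation on S[T_{i,j}]: there is no infinite sequence f_0 → f_1 → f_2 → … of one-step reductions of polynomials with respect to G'. -/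
namespace MonomialOrd

variable {V : Type*}

theorem wellFounded [Finite V] (ord : MonomialOrd V) : WellFounded (flip ord.gt) := by
  have : IsTrans (V →₀ ℕ) ord.gt := ⟨fun _ _ _ h₁ h₂ => ord.trans h₁ h₂⟩
  rw [wellFounded_iff_isEmpty_descending_chain]
  refine ⟨fun ⟨f, hf⟩ => ?_⟩
  obtain ⟨a, b, hab, hle⟩ := wellQuasiOrdered_le f
  have hgt : ord.gt (f a) (f b) := Nat.rel_of_forall_rel_succ_of_lt ord.gt hf hab
  obtain ⟨c, hc⟩ := exists_add_of_le hle
  rcases eq_or_ne c 0 with rfl | hc0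
  · rw [hc, add_zero] at hgt
    exact ord.irrefl _ hgt
  · have := ord.add_right (f a) (ord.gt_zero c hc0)
    rw [zero_add, add_comm, ← hc] at this
    exact ord.irrefl _ (ord.trans hgt this)

end MonomialOrd

/-- Reducing the polynomial `f` at the monomial `m` removes `m` and can only create or cancel
the monomial that `m` reduces to. -/
theorem transGen_cutExpand_support_of_polyReduces {V K : Type*} [Field K]
    {G : Set (MarkedBinomial V)} {lt : (V →₀ ℕ) → (V →₀ ℕ) → Prop}
    (hlt : ∀ m m', Reduces G m m' → lt m' m) {f f' : MvPolynomial V K}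
    (h : PolyReduces G f f') :
    Relation.TransGen (Relation.CutExpand lt) f'.support.val f.support.val := by
  classical
  obtain ⟨g, hg, m, hm, hle, rfl⟩ := h
  set m' := m - g.head + g.tail with hm'
  have hr : lt m' m := hlt m m' ⟨g, hg, hle, rfl⟩
  set c := MvPolynomial.coeff m f
  set f' := f - MvPolynomial.monomial (m - g.head) c * g.toPoly K with hf'
  have hcoeff : ∀ w, MvPolynomial.coeff w f' =
      MvPolynomial.coeff w f - (if m = w then c else 0) + (if m' = w then c else 0) := by
    intro w
    rw [hf', MarkedBinomial.toPoly, mul_sub, MvPolynomial.monomial_mul,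
      MvPolynomial.monomial_mul, tsub_add_cancel_of_le hle, ← hm']
    simp only [MvPolynomial.coeff_sub, MvPolynomial.coeff_monomial, mul_one]
    ring
  have hmem : ∀ w, w ≠ m' → (w ∈ f'.support ↔ w ∈ f.support.erase m) := by
    intro w hw
    rw [Finset.mem_erase, MvPolynomial.mem_support_iff, MvPolynomial.mem_support_iff, hcoeff,
      if_neg hw.symm, add_zero]
    by_cases hwm : m = w
    · subst hwm; simp [c]
    · simp [hwm, Ne.symm hwm]
  have hcut : Relation.CutExpand lt (f.support.erase m).val f.support.val := by
    refine ⟨0, m, by simp, ?_⟩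
    rw [Finset.erase_val, add_zero, add_comm, Multiset.singleton_add,
      Multiset.cons_erase (Finset.mem_def.1 hm)]
  by_cases h₁ : m' ∈ f'.support <;> by_cases h₂ : m' ∈ f.support.erase m
  · rw [show f'.support = f.support.erase m by
      ext w; by_cases hw : w = m'
      · subst hw; exact iff_of_true h₁ h₂
      · exact hmem w hw]
    exact .single hcut
  · have he : f'.support = insert m' (f.support.erase m) := by
      ext w; by_cases hw : w = m'
      · subst hw; simpa using h₁
      · rw [hmem w hw, Finset.mem_insert, or_iff_right hw]
    refine .single ⟨{m'}, m, by simpa using hr, ?_⟩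
    rw [he, Finset.insert_val_of_notMem h₂, Finset.erase_val, add_comm, Multiset.singleton_add,
      Multiset.cons_swap, Multiset.cons_erase (Finset.mem_def.1 hm), add_comm,
      Multiset.singleton_add]
  · have he : f'.support = (f.support.erase m).erase m' := by
      ext w; by_cases hw : w = m'
      · subst hw; simpa using h₁
      · rw [hmem w hw, Finset.mem_erase (a := w) (b := m'), and_iff_right hw]
    refine .head ⟨0, m', by simp, ?_⟩ (.single hcut)
    rw [he, Finset.erase_val _ m', add_zero, add_comm, Multiset.singleton_add,
      Multiset.cons_erase (Finset.mem_def.1 h₂)]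
  · rw [show f'.support = f.support.erase m by
      ext w; by_cases hw : w = m'
      · subst hw; exact iff_of_false h₁ h₂
      · exact hmem w hw]
    exact .single hcut

/-- Polynomial reduction terminates as soon as monomial reduction decreases a well-founded
relation. -/
theorem not_exists_polyReduces_chain {V K : Type*} [Field K]
    {G : Set (MarkedBinomial V)} {lt : (V →₀ ℕ) → (V →₀ ℕ) → Prop} (hwf : WellFounded lt)
    (hlt : ∀ m m', Reduces G m m' → lt m' m) :
    ¬ ∃ f : ℕ → MvPolynomial V K, ∀ k, PolyReduces G (f k) (f (k + 1)) := by
  rintro ⟨f, hf⟩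
  exact (wellFounded_iff_isEmpty_descending_chain.1 hwf.cutExpand.transGen).false
    ⟨fun k => (f k).support.val,
      fun k => transGen_cutExpand_support_of_polyReduces hlt (hf k)⟩

/-- The weight of the `x`-part of a monomial, where `x_i` has weight `n - i`. -/
def xWeight {n : ℕ} {V : Type*} (m : Fin n ⊕ V →₀ ℕ) : ℕ :=
  ∑ i : Fin n, m (Sum.inl i) * (n - i)

theorem xWeight_add {n : ℕ} {V : Type*} (m m' : Fin n ⊕ V →₀ ℕ) :
    xWeight (m + m') = xWeight m + xWeight m' := by
  simp [xWeight, add_mul, Finset.sum_add_distrib]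

theorem xWeight_single_inl {n : ℕ} {V : Type*} (i : Fin n) :
    xWeight (Finsupp.single (Sum.inl i) 1 : Fin n ⊕ V →₀ ℕ) = n - i := by
  classical
  simp [xWeight, Finsupp.single_apply]

theorem xWeight_mapDomain_inr {n : ℕ} {V : Type*} (m : V →₀ ℕ) :
    xWeight (Finsupp.mapDomain Sum.inr m : Fin n ⊕ V →₀ ℕ) = 0 := by
  simp [xWeight, Finsupp.mapDomain_of_notMem_range]

theorem xWeight_single_inr {n : ℕ} {V : Type*} (v : V) :
    xWeight (Finsupp.single (Sum.inr v) 1 : Fin n ⊕ V →₀ ℕ) = 0 := by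
  simp [xWeight]

/-- The exponent vector of the `T`-part of a monomial. -/
noncomputable def tPart {W V : Type*} (m : W ⊕ V →₀ ℕ) : V →₀ ℕ :=
  Finsupp.comapDomain Sum.inr m Sum.inr_injective.injOn

theorem tPart_add_mapDomain {W V : Type*} (m : W ⊕ V →₀ ℕ) (t : V →₀ ℕ) :
    tPart (m + Finsupp.mapDomain Sum.inr t) = tPart m + t := by
  ext v
  simp [tPart, Finsupp.mapDomain_apply Sum.inr_injective]

/-- If `G` is a Gröbner basis (with respect to some monomial order, with
marked terms as initial terms) of the toric ideal `ker φ'` of the special fiber of a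
collection of strongly stable ideals, each generated in a single degree, then the marked
collection `G' = {x_i T_{l,k} − x_j T_{l,k'} : i < j, x_i u_{l,k} = x_j u_{l,k'}} ∪ G`
defines a Noetherian reduction relation on `S[T_{i,j}]`: there is no infinite chain of
one-step polynomial reductions with respect to `G'`. -/
theorem multiRees_syzygies_Noetherian_reduction {n r : ℕ} {K : Type} [Field K]
    (s : Fin r → ℕ) (d : Fin r → ℕ)
    (u : (i : Fin r) → Fin (s i) → (Fin n →₀ ℕ))
    (hdeg : ∀ i j, ((u i j).sum fun _ e => e) = d i)
    (hmin : ∀ i, Function.Injective (u i))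
    (I : Fin r → Ideal (MvPolynomial (Fin n) K))
    (hI : ∀ i, I i = Ideal.span (Set.range fun j => (MvPolynomial.monomial (u i j) (1 : K))))
    (hSS : ∀ i, StronglyStable (I i))
    (φ' : MvPolynomial ((i : Fin r) × Fin (s i)) K →ₐ[K] MvPolynomial (Fin n ⊕ Fin r) K)
    (hφ' : φ' = MvPolynomial.aeval (fun p => MvPolynomial.monomial
      (Finsupp.mapDomain Sum.inl (u p.1 p.2) + Finsupp.single (Sum.inr p.1) 1) 1))
    (G : Finset (MarkedBinomial ((i : Fin r) × Fin (s i))))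
    (hG : ∃ ord : MonomialOrd ((i : Fin r) × Fin (s i)),
      IsMarkedGB ord.gt (G : Set (MarkedBinomial ((i : Fin r) × Fin (s i))))
        (RingHom.ker φ'.toRingHom)) :
    ¬ ∃ f : ℕ → MvPolynomial (Fin n ⊕ ((i : Fin r) × Fin (s i))) K,
        ∀ k : ℕ,
          PolyReduces
            ({g : MarkedBinomial (Fin n ⊕ ((i : Fin r) × Fin (s i))) |
                ∃ (i j : Fin n) (l : Fin r) (k k' : Fin (s l)), i < j ∧
                  Finsupp.single i 1 + u l k = Finsupp.single j 1 + u l k' ∧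
                  g.head = Finsupp.single (Sum.inl i) 1 + Finsupp.single (Sum.inr ⟨l, k⟩) 1 ∧
                  g.tail = Finsupp.single (Sum.inl j) 1 + Finsupp.single (Sum.inr ⟨l, k'⟩) 1}
              ∪ (MarkedBinomial.map Sum.inr ''
                  (G : Set (MarkedBinomial ((i : Fin r) × Fin (s i))))))
            (f k) (f (k + 1)) := by
  obtain ⟨ord, -, hord, -⟩ := hG
  refine not_exists_polyReduces_chain
    (InvImage.wf (fun m => (xWeight m, tPart m))
      (WellFounded.prod_lex Nat.lt_wfRel.wf ord.wellFounded)) ?_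
  rintro m _ ⟨g, hg, hle, rfl⟩
  obtain ⟨c, rfl⟩ := exists_add_of_le hle
  rw [add_tsub_cancel_left, add_comm g.head c]
  change Prod.Lex _ _ _ _
  rcases hg with ⟨i, j, l, k, k', hij, -, hh, ht⟩ | ⟨g, hg, rfl⟩
  · refine Prod.Lex.left _ _ ?_
    rw [hh, ht]
    simp only [xWeight_add, xWeight_single_inl, xWeight_single_inr]
    have := i.isLt
    change _ < _
    omega
  · simp only [MarkedBinomial.map, xWeight_add, xWeight_mapDomain_inr, tPart_add_mapDomain]
    refine Prod.Lex.right _ ?_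
    rw [add_comm _ g.tail, add_comm _ g.head]
    exact ord.add_right _ (hord g hg)
end

section
/- Let I = B(M,N) ⊆ S = K[x_1, …, x_n] be the strongly stable ideal with Borel generators M = x_a·x_b and N = x_c·x_d, where c < a ≤ b < d, and let G₁ = { T_u T_v − T_{u'} T_{v'} : u·v = u'·v' and u, v ≻_rlex v' } be marked at the terms T_u T_v. Then for every monomial μ ∈ S, the fiber graph Γ_μ(I) with respect to G₁ is either empty or has a unique sink. -/
theorem fiberMap_add {V W : Type*} (u : V → (W →₀ ℕ)) (S T : V →₀ ℕ) :
    fiberMap u (S + T) = fiberMap u S + fiberMap u T :=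
  map_add (Finsupp.weight u) S T

theorem fiberMap_single_one {V W : Type*} (u : V → (W →₀ ℕ)) (v : V) :
    fiberMap u (Finsupp.single v 1) = u v := by
  simp [fiberMap]

/-- Variables occurring in the image of a monomial occur in the image of one of its factors. -/
theorem exists_mem_support_of_fiberMap_ne_zero {V W : Type*} (u : V → (W →₀ ℕ)) (T : V →₀ ℕ)
    (x : W) (hx : fiberMap u T x ≠ 0) : ∃ v ∈ T.support, u v x ≠ 0 := by
  rw [fiberMap, Finsupp.sum, Finsupp.finsetSum_apply] at hx
  obtain ⟨v, hv, hne⟩ := Finset.exists_ne_zero_of_sum_ne_zero hx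
  exact ⟨v, hv, fun h => hne (by simp [h])⟩

theorem Finsupp.exists_eq_single_add {V : Type*} {T : V →₀ ℕ} {v : V} (hv : v ∈ T.support) :
    ∃ R, T = Finsupp.single v 1 + R := by
  have h : Finsupp.single v 1 ≤ T := by
    rw [Finsupp.single_le_iff]
    exact Nat.one_le_iff_ne_zero.mpr (Finsupp.mem_support_iff.mp hv)
  exact ⟨T - Finsupp.single v 1, (add_tsub_cancel_of_le h).symm⟩

/-- A monomial to which no marked binomial of `G` applies. -/
def IsFullyReduced {V : Type*} (G : Set (MarkedBinomial V)) (T : V →₀ ℕ) : Prop :=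
  ∀ T', ¬ Reduces G T T'

theorem IsFullyReduced.of_add_left {V : Type*} {G : Set (MarkedBinomial V)} {S R : V →₀ ℕ}
    (h : IsFullyReduced G (S + R)) : IsFullyReduced G R := by
  rintro _ ⟨g, hg, hle, -⟩
  exact h _ ⟨g, hg, hle.trans le_add_self, rfl⟩

theorem RlexGt.trans {n : ℕ} {u v w : Fin n →₀ ℕ} (h : RlexGt u v) (h' : RlexGt v w) :
    RlexGt u w := by
  obtain ⟨k, hk, hk'⟩ := h
  obtain ⟨l, hl, hl'⟩ := h'
  rcases lt_trichotomy k l with hkl | rfl | hkl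
  · exact ⟨l, (hk' l hkl).trans_lt hl, fun m hm => (hk' m (hkl.trans hm)).trans (hl' m hm)⟩
  · exact ⟨k, hk.trans hl, fun m hm => (hk' m hm).trans (hl' m hm)⟩
  · exact ⟨k, hk.trans_eq (hl' k hkl), fun m hm => (hk' m hm).trans (hl' m (hkl.trans hm))⟩

theorem RlexGt.irrefl {n : ℕ} (u : Fin n →₀ ℕ) : ¬ RlexGt u u :=
  fun ⟨_, hk, _⟩ => lt_irrefl _ hk

/-- Replacing a variable by one of larger index makes a monomial smaller for `≻_rlex`. -/
theorem rlexGt_single_add_of_lt {n : ℕ} {i j : Fin n} (h : i < j) (m : Fin n →₀ ℕ) :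
    RlexGt (Finsupp.single i 1 + m) (Finsupp.single j 1 + m) := by
  refine ⟨j, ?_, fun l hl => ?_⟩
  · simp [h.ne]
  · simp [hl.ne, (h.trans hl).ne]

/-- Among quadratic monomials, one whose largest variable has smaller index is `≻_rlex`-larger. -/
theorem rlexGt_of_max_lt {n : ℕ} {i j k l : Fin n} (hkl : k ≤ l) (hij : i ≤ j) (h : l < j) :
    RlexGt (Finsupp.single k 1 + Finsupp.single l 1)
      (Finsupp.single i 1 + Finsupp.single j 1 : Fin n →₀ ℕ) := by
  refine ⟨j, ?_, fun m hm => ?_⟩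
  · simp [h.ne, (hkl.trans_lt h).ne]
  · simp [hm.ne, (h.trans hm).ne, (hij.trans_lt hm).ne, ((hkl.trans_lt h).trans hm).ne]

/-- The number of elements of `B` that are `≻_rlex`-larger than `v`. -/
noncomputable def rlexRank {n : ℕ} (B : Set (Fin n →₀ ℕ)) (v : B) : ℕ :=
  {w : B | RlexGt (w : Fin n →₀ ℕ) v}.ncard

theorem rlexRank_lt {n : ℕ} {B : Set (Fin n →₀ ℕ)} [Finite B] {u v : B}
    (h : RlexGt (u : Fin n →₀ ℕ) v) : rlexRank B u < rlexRank B v := by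
  refine Set.ncard_lt_ncard ⟨fun w hw => RlexGt.trans hw h, fun hsub => ?_⟩ (Set.toFinite _)
  exact RlexGt.irrefl _ (hsub h)

/-- If every tail contains a variable of rank larger than both variables of the quadratic head,
then every nonempty fiber contains a reduced monomial. -/
theorem exists_isFullyReduced {V W : Type*} [Finite V] (G : Set (MarkedBinomial V))
    (φ : V → (W →₀ ℕ)) (r : V → ℕ) (hφ : ∀ v, φ v ≠ 0)
    (hG : ∀ g ∈ G, ∃ u v u' v' : V, φ u + φ v = φ u' + φ v' ∧ r u < r v' ∧ r v < r v' ∧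
      g.head = Finsupp.single u 1 + Finsupp.single v 1 ∧
      g.tail = Finsupp.single u' 1 + Finsupp.single v' 1)
    (T₀ : V →₀ ℕ) : ∃ T, fiberMap φ T = fiberMap φ T₀ ∧ IsFullyReduced G T := by
  let ω : (V →₀ ℕ) →+ ℕ := Finsupp.weight fun v => 3 ^ r v
  have hω1 (v : V) : ω (Finsupp.single v 1) = 3 ^ r v := by simp [ω, Finsupp.weight_single]
  have hstep (T T' : V →₀ ℕ) (h : Reduces G T T') :
      fiberMap φ T' = fiberMap φ T ∧ ω T < ω T' := by
    obtain ⟨g, hg, hle, rfl⟩ := h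
    obtain ⟨u, v, u', v', huv, hu, hv, hhead, htail⟩ := hG g hg
    obtain ⟨R, rfl⟩ := exists_add_of_le hle
    rw [add_tsub_cancel_left, add_comm g.head, hhead, htail]
    refine ⟨by simp only [fiberMap_add, fiberMap_single_one, huv], ?_⟩
    simp only [map_add, hω1]
    have h1 : 3 ^ (r u + 1) ≤ 3 ^ r v' := Nat.pow_le_pow_right (by norm_num) hu
    have h2 : 3 ^ (r v + 1) ≤ 3 ^ r v' := Nat.pow_le_pow_right (by norm_num) hv
    have h3 : 0 < 3 ^ r v' := by positivity
    have h4 : 0 < 3 ^ r u' := by positivity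
    rw [pow_succ] at h1 h2
    omega
  obtain ⟨C, hC⟩ := (Set.finite_range fun v => 3 ^ r v).bddAbove
  have hbound (T : V →₀ ℕ) : ω T ≤ C * (fiberMap φ T).degree := by
    induction T using Finsupp.induction_linear with
    | zero => simp
    | add S T hS hT =>
      rw [fiberMap_add, map_add, map_add, mul_add]
      exact add_le_add hS hT
    | single v e =>
      have h1 : 3 ^ r v ≤ C := hC ⟨v, rfl⟩
      have h2 : 1 ≤ (φ v).degree := by
        rw [Nat.one_le_iff_ne_zero, Ne, Finsupp.degree_eq_zero_iff]
        exact hφ v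
      have h3 : fiberMap φ (Finsupp.single v e) = e • φ v := by simp [fiberMap]
      have h4 : ω (Finsupp.single v e) = e * 3 ^ r v := by simp [ω, Finsupp.weight_single]
      rw [h3, h4, map_nsmul, smul_eq_mul]
      nlinarith [Nat.mul_le_mul (Nat.mul_le_mul_left e h1) h2]
  let s : Set ℕ := ω '' {T | fiberMap φ T = fiberMap φ T₀}
  have hs : BddAbove s := by
    refine ⟨C * (fiberMap φ T₀).degree, ?_⟩
    rintro _ ⟨T, hT, rfl⟩
    exact (hbound T).trans_eq (by rw [hT])
  obtain ⟨T, hT, hmax⟩ := Nat.sSup_mem (s := s) ⟨ω T₀, T₀, rfl, rfl⟩ hs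
  refine ⟨T, hT, fun T' h => ?_⟩
  obtain ⟨h1, h2⟩ := hstep T T' h
  have h3 : ω T' ≤ sSup s := le_csSup hs ⟨T', h1.trans hT, rfl⟩
  omega

/-- The largest index `i` for which `x_i x_j` may lie in `B(x_a x_b, x_c x_d)`, for `i ≤ j`. -/
def partnerBound {n : ℕ} (a b c j : Fin n) : Fin n :=
  if j ≤ b then a else c

section Generators

variable {n : ℕ} {a b c d : Fin n}

theorem finite_BM_union_BN : (BM a b ∪ BN b c d).Finite := by
  refine (Set.finite_range fun p : Fin n × Fin n =>
    (Finsupp.single p.1 1 + Finsupp.single p.2 1 : Fin n →₀ ℕ)).subset ?_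
  rintro m (⟨i, j, -, -, -, rfl⟩ | ⟨i, j, -, -, -, rfl⟩) <;> exact ⟨(i, j), rfl⟩

theorem ne_zero_of_mem {m : Fin n →₀ ℕ} (hm : m ∈ BM a b ∪ BN b c d) : m ≠ 0 := by
  rcases hm with ⟨i, j, -, -, -, rfl⟩ | ⟨i, j, -, -, -, rfl⟩ <;> simp

theorem partnerBound_le (h1 : c < a) (j : Fin n) : partnerBound a b c j ≤ a := by
  unfold partnerBound
  split_ifs
  exacts [le_rfl, h1.le]

theorem single_add_single_mem (h2 : a ≤ b) {i j : Fin n}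
    (hi : i ≤ partnerBound a b c j) (hj : j ≤ d) :
    (Finsupp.single i 1 + Finsupp.single j 1 : Fin n →₀ ℕ) ∈ BM a b ∪ BN b c d := by
  unfold partnerBound at hi
  split_ifs at hi with h
  · left
    rcases le_total i j with hij | hij
    · exact ⟨i, j, hij, hi, h, rfl⟩
    · exact ⟨j, i, hij, hij.trans hi, hi.trans h2, add_comm _ _⟩
  · exact Or.inr ⟨i, j, hi, not_le.mp h, hj, rfl⟩

theorem exists_eq_of_mem (h1 : c < a) (h2 : a ≤ b) (h3 : b < d) {m : Fin n →₀ ℕ}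
    (hm : m ∈ BM a b ∪ BN b c d) :
    ∃ i j, i ≤ j ∧ i ≤ partnerBound a b c j ∧ j ≤ d ∧
      m = Finsupp.single i 1 + Finsupp.single j 1 := by
  rcases hm with ⟨i, j, hij, hi, hj, rfl⟩ | ⟨i, j, hi, hbj, hj, rfl⟩
  · exact ⟨i, j, hij, by simpa [partnerBound, hj] using hi, hj.trans h3.le, rfl⟩
  · exact ⟨i, j, ((hi.trans h1.le).trans h2).trans hbj.le,
      by simpa [partnerBound, hbj.not_ge] using hi, hj, rfl⟩

/-- `x_l` is the largest variable of `μ`, and `x_k` is the largest variable of `μ / x_l` that can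
be paired with `x_l`. -/
structure IsTopPair (a b c : Fin n) (μ : Fin n →₀ ℕ) (k l : Fin n) : Prop where
  exists_eq : ∃ ν, μ = Finsupp.single l 1 + ν ∧ ν k ≠ 0 ∧
    ∀ x, ν x ≠ 0 → x ≤ partnerBound a b c l → x ≤ k
  le_max : ∀ x, μ x ≠ 0 → x ≤ l
  le_bound : k ≤ partnerBound a b c l

theorem IsTopPair.unique {μ : Fin n →₀ ℕ} {k l k' l' : Fin n} (h : IsTopPair a b c μ k l)
    (h' : IsTopPair a b c μ k' l') : k = k' ∧ l = l' := by
  obtain ⟨⟨ν, hν, hk, hmax⟩, hl, hb⟩ := h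
  obtain ⟨⟨ν', hν', hk', hmax'⟩, hl', hb'⟩ := h'
  obtain rfl : l = l' := le_antisymm (hl' l (by simp [hν])) (hl l' (by simp [hν']))
  obtain rfl : ν = ν' := add_left_cancel (hν.symm.trans hν')
  exact ⟨le_antisymm (hmax' k hk hb) (hmax k' hk' hb'), rfl⟩

/-- In a monomial that is reduced with respect to `G₁`, the `≻_rlex`-smallest factor is the top
pair of its image. -/
theorem exists_isTopPair_of_isFullyReduced (h1 : c < a) (h2 : a ≤ b) (h3 : b < d)
    {T : ↥(BM a b ∪ BN b c d) →₀ ℕ} (hT : IsFullyReduced (G1 a b c d) T) (h0 : T ≠ 0) :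
    ∃ w ∈ T.support, ∃ k l, (w : Fin n →₀ ℕ) = Finsupp.single k 1 + Finsupp.single l 1 ∧
      IsTopPair a b c (fiberMap (fun w : ↥(BM a b ∪ BN b c d) => (w : Fin n →₀ ℕ)) T) k l := by
  have : Finite ↥(BM a b ∪ BN b c d) := finite_BM_union_BN
  obtain ⟨w, hw, hmin⟩ := T.support.exists_max_image (rlexRank _)
    (Finsupp.support_nonempty_iff.mpr h0)
  replace hmin : ∀ v ∈ T.support, ¬ RlexGt (w : Fin n →₀ ℕ) v :=
    fun v hv h => (rlexRank_lt h).not_ge (hmin v hv)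
  obtain ⟨k, l, hkl, hk, hl, hwkl⟩ := exists_eq_of_mem h1 h2 h3 w.2
  obtain ⟨R, rfl⟩ := Finsupp.exists_eq_single_add hw
  -- Otherwise exchanging `k` with `x` in `w` and another factor of `T` reduces `T`.
  have key : ∀ x, fiberMap (fun w : ↥(BM a b ∪ BN b c d) => (w : Fin n →₀ ℕ)) R x ≠ 0 →
      x ≤ l ∧ (x ≤ partnerBound a b c l → x ≤ k) := by
    intro x hx
    obtain ⟨v, hv, hvx⟩ := exists_mem_support_of_fiberMap_ne_zero _ R x hx
    have hwv : ¬ RlexGt (w : Fin n →₀ ℕ) v := hmin v (by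
      rw [Finsupp.mem_support_iff] at hv ⊢
      simp [hv])
    obtain ⟨R', rfl⟩ := Finsupp.exists_eq_single_add hv
    obtain ⟨i, j, hij, hi, hj, hvij⟩ := exists_eq_of_mem h1 h2 h3 v.2
    have hjl : j ≤ l := by
      by_contra! h
      exact hwv (by rw [hwkl, hvij]; exact rlexGt_of_max_lt hkl hij h)
    obtain ⟨y, hvxy, hxl, hyl, hmem⟩ : ∃ y,
        (v : Fin n →₀ ℕ) = Finsupp.single y 1 + Finsupp.single x 1 ∧ x ≤ l ∧ y ≤ l ∧
        (k ≤ x → x ≤ partnerBound a b c l →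
          (Finsupp.single k 1 + Finsupp.single y 1 : Fin n →₀ ℕ) ∈ BM a b ∪ BN b c d) := by
      have hxij : x = i ∨ x = j := by
        by_contra! h
        exact hvx (by simp [hvij, h.1.symm, h.2.symm])
      rcases hxij with rfl | rfl
      · exact ⟨j, by rw [hvij, add_comm], hij.trans hjl, hjl,
          fun h _ => single_add_single_mem h2 (h.trans hi) hj⟩
      · refine ⟨i, hvij, hjl, hij.trans hjl, fun h hx => ?_⟩
        have hia := hi.trans (partnerBound_le h1 _)
        refine single_add_single_mem h2 ?_ (hij.trans hj)
        rw [partnerBound, if_pos (hia.trans h2)]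
        exact (h.trans hx).trans (partnerBound_le h1 _)
    refine ⟨hxl, fun hxb => ?_⟩
    by_contra! hkx
    have hgt : RlexGt (w : Fin n →₀ ℕ) (Finsupp.single x 1 + Finsupp.single l 1) :=
      hwkl ▸ rlexGt_single_add_of_lt hkx _
    have hyl' : y < l := by
      refine hyl.lt_of_ne ?_
      rintro rfl
      exact hwv (by rwa [hvxy, add_comm])
    have hgt' : RlexGt (v : Fin n →₀ ℕ) (Finsupp.single x 1 + Finsupp.single l 1) := by
      rw [hvxy, add_comm (Finsupp.single x 1)]
      exact rlexGt_single_add_of_lt hyl' _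
    refine hT _ ⟨⟨Finsupp.single w 1 + Finsupp.single v 1,
      Finsupp.single ⟨_, hmem hkx.le hxb⟩ 1 +
        Finsupp.single ⟨_, single_add_single_mem h2 hxb hl⟩ 1⟩,
      ⟨w, v, _, _, ?_, hgt, hgt', rfl, rfl⟩, ?_, rfl⟩
    · rw [hwkl, hvxy, add_add_add_comm, add_comm (Finsupp.single l 1)]
    · rw [← add_assoc]
      exact le_self_add
  have hsum : fiberMap (fun w : ↥(BM a b ∪ BN b c d) => (w : Fin n →₀ ℕ))
      (Finsupp.single w 1 + R) = Finsupp.single l 1 + (Finsupp.single k 1 +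
        fiberMap (fun w : ↥(BM a b ∪ BN b c d) => (w : Fin n →₀ ℕ)) R) := by
    rw [fiberMap_add, fiberMap_single_one, hwkl]
    abel
  refine ⟨w, hw, k, l, hwkl, ⟨_, hsum, by simp, fun x hx hxb => ?_⟩, fun x hx => ?_, hk⟩
  · by_cases hxk : k = x
    · exact hxk.ge
    · exact (key x (by simpa [Finsupp.single_apply, hxk] using hx)).2 hxb
  · rw [hsum] at hx
    by_cases hxl : l = x
    · exact hxl.ge
    by_cases hxk : k = x
    · exact hxk ▸ hkl
    · exact (key x (by simpa [Finsupp.single_apply, hxk, hxl] using hx)).1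

theorem fiberMap_ne_zero {T : ↥(BM a b ∪ BN b c d) →₀ ℕ} (hT : T ≠ 0) :
    fiberMap (fun w : ↥(BM a b ∪ BN b c d) => (w : Fin n →₀ ℕ)) T ≠ 0 := by
  obtain ⟨w, hw⟩ := Finsupp.support_nonempty_iff.mpr hT
  obtain ⟨R, rfl⟩ := Finsupp.exists_eq_single_add hw
  rw [fiberMap_add, fiberMap_single_one]
  exact fun h => ne_zero_of_mem w.2 (add_eq_zero.mp h).1

/-- A fiber contains at most one monomial that is reduced with respect to `G₁`. -/
theorem IsFullyReduced.eq_of_fiberMap_eq (h1 : c < a) (h2 : a ≤ b) (h3 : b < d)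
    {T T' : ↥(BM a b ∪ BN b c d) →₀ ℕ} (hT : IsFullyReduced (G1 a b c d) T)
    (hT' : IsFullyReduced (G1 a b c d) T')
    (h : fiberMap (fun w : ↥(BM a b ∪ BN b c d) => (w : Fin n →₀ ℕ)) T =
      fiberMap (fun w : ↥(BM a b ∪ BN b c d) => (w : Fin n →₀ ℕ)) T') : T = T' := by
  induction hN : T.degree generalizing T T' with
  | zero =>
    obtain rfl : T = 0 := (Finsupp.degree_eq_zero_iff T).mp hN
    by_contra hne
    exact fiberMap_ne_zero (Ne.symm hne) (h.symm.trans (by simp [fiberMap]))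
  | succ N ih =>
    have h0 : T ≠ 0 := by
      rintro rfl
      simp at hN
    have h0' : T' ≠ 0 := by
      rintro rfl
      exact fiberMap_ne_zero h0 (h.trans (by simp [fiberMap]))
    obtain ⟨w, hw, k, l, hwkl, htop⟩ := exists_isTopPair_of_isFullyReduced h1 h2 h3 hT h0
    obtain ⟨w', hw', k', l', hwkl', htop'⟩ := exists_isTopPair_of_isFullyReduced h1 h2 h3 hT' h0'
    obtain ⟨rfl, rfl⟩ := htop.unique (h ▸ htop')
    obtain rfl : w = w' := Subtype.ext (hwkl.trans hwkl'.symm)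
    obtain ⟨R, rfl⟩ := Finsupp.exists_eq_single_add hw
    obtain ⟨R', rfl⟩ := Finsupp.exists_eq_single_add hw'
    rw [fiberMap_add, fiberMap_add] at h
    rw [ih hT.of_add_left hT'.of_add_left (add_left_cancel h) (by
      rw [map_add, Finsupp.degree_single] at hN
      omega)]

theorem isFiberSink_G1_iff {μ : Fin n →₀ ℕ} {T : ↥(BM a b ∪ BN b c d) →₀ ℕ} :
    IsFiberSink (G1 a b c d) (fun w : ↥(BM a b ∪ BN b c d) => (w : Fin n →₀ ℕ)) μ T ↔
      fiberMap (fun w : ↥(BM a b ∪ BN b c d) => (w : Fin n →₀ ℕ)) T = μ ∧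
        IsFullyReduced (G1 a b c d) T := by
  refine and_congr_right fun hT => forall_congr' fun T' =>
    ⟨fun h hred => h hred ?_, fun h hred => (h hred).elim⟩
  obtain ⟨g, ⟨u, v, u', v', huv, -, -, hhead, htail⟩, hle, rfl⟩ := hred
  obtain ⟨R, rfl⟩ := exists_add_of_le hle
  rw [← hT, add_tsub_cancel_left, add_comm g.head, hhead, htail]
  simp only [fiberMap_add, fiberMap_single_one, huv]

end Generators

/-- For the strongly stable ideal `I = B(x_a x_b, x_c x_d)` with
`c < a ≤ b < d` and the marked collection `G₁`, every fiber graph `Γ_μ(I)` with respect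
to `G₁` is either empty or has a unique sink. -/
theorem G1_fiberGraph_unique_sink {n : ℕ} (a b c d : Fin n)
    (h1 : c < a) (h2 : a ≤ b) (h3 : b < d) :
    ∀ μ : Fin n →₀ ℕ,
      (∀ T : ↥(BM a b ∪ BN b c d) →₀ ℕ,
        fiberMap (fun w : ↥(BM a b ∪ BN b c d) => (w : Fin n →₀ ℕ)) T ≠ μ) ∨
      (∃! T : ↥(BM a b ∪ BN b c d) →₀ ℕ,
        IsFiberSink (G1 a b c d) (fun w : ↥(BM a b ∪ BN b c d) => (w : Fin n →₀ ℕ)) μ T) := by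
  intro μ
  by_cases hμ : ∀ T : ↥(BM a b ∪ BN b c d) →₀ ℕ,
      fiberMap (fun w : ↥(BM a b ∪ BN b c d) => (w : Fin n →₀ ℕ)) T ≠ μ
  · exact Or.inl hμ
  push Not at hμ
  obtain ⟨T₀, rfl⟩ := hμ
  have : Finite ↥(BM a b ∪ BN b c d) := finite_BM_union_BN
  obtain ⟨T, hT, hred⟩ := exists_isFullyReduced (G1 a b c d)
    (fun w : ↥(BM a b ∪ BN b c d) => (w : Fin n →₀ ℕ)) (rlexRank _) (fun w => ne_zero_of_mem w.2)
    (fun g ⟨u, v, u', v', huv, hu, hv, hg⟩ =>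
      ⟨u, v, u', v', huv, rlexRank_lt hu, rlexRank_lt hv, hg⟩) T₀
  refine Or.inr ⟨T, isFiberSink_G1_iff.mpr ⟨hT, hred⟩, fun T' hT' => ?_⟩
  obtain ⟨hT', hred'⟩ := isFiberSink_G1_iff.mp hT'
  exact hred'.eq_of_fiberMap_eq h1 h2 h3 hred (hT'.trans hT.symm)
end
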